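/- Every infinite virtually BFC group does not admit a DTC ultrafilter; that is, if an infinite group G has a subgroup of finite index that is BFC, then for every v ∈ βG there exists u ∈ βG \ G with u ⋄ v = u ∘ v. -/

import Mathlib

open scoped Pointwise

/-- The product `u ⋄ v` on ultrafilters: `A ∈ u ⋄ v ↔ {x | x⁻¹A ∈ v} ∈ u`. -/
def dprod {G : Type*} [Group G] (u v : Ultrafilter G) : Ultrafilter G :=
  u.bind fun x => v.map fun y => x * y

/-- The product `u ∘ v` on ultrafilters: `A ∈ u ∘ v ↔ {x | Ax⁻¹ ∈ u} ∈ v`. -/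
def cprod {G : Type*} [Group G] (u v : Ultrafilter G) : Ultrafilter G :=
  v.bind fun y => u.map fun x => x * y

/-- Membership characterization of `u ⋄ v`: here `{y | x * y ∈ A}` is the set `x⁻¹A`. -/
theorem mem_dprod {G : Type*} [Group G] (u v : Ultrafilter G) (A : Set G) :
    A ∈ dprod u v ↔ {x : G | {y : G | x * y ∈ A} ∈ v} ∈ u := Iff.rfl

/-- Membership characterization of `u ∘ v`: here `{x | x * y ∈ A}` is the set `Ay⁻¹`. -/
theorem mem_cprod {G : Type*} [Group G] (u v : Ultrafilter G) (A : Set G) :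
    A ∈ cprod u v ↔ {y : G | {x : G | x * y ∈ A} ∈ u} ∈ v := Iff.rfl

/-- `u ∈ βG` is principal, i.e. belongs to the copy of `G` inside `βG`. -/
def IsPrincipal {G : Type*} (u : Ultrafilter G) : Prop :=
  ∃ x : G, u = pure x

/-- `v` is a DTC ultrafilter for `βG`: `u ⋄ v ≠ u ∘ v` for every `u ∈ βG \ G`. -/
def IsDTC {G : Type*} [Group G] (v : Ultrafilter G) : Prop :=
  ∀ u : Ultrafilter G, ¬IsPrincipal u → dprod u v ≠ cprod u v


open Filter

/-- The centralizer of a finite set of elements with finite conjugacy classes has finite index. -/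
theorem finiteIndex_centralizer_of_finite {G : Type*} [Group G]
    (hfc : ∀ y : G, (Set.range fun x : G => x⁻¹ * y * x).Finite) {S : Set G} (hS : S.Finite) :
    (Subgroup.centralizer S).FiniteIndex := by
  have single (y : G) : (Subgroup.centralizer {y}).FiniteIndex := by
    have := (hfc y).to_subtype
    let f : G ⧸ Subgroup.centralizer {y} → Set.range fun x : G => x⁻¹ * y * x :=
      fun q => ⟨q.out * y * q.out⁻¹, q.out⁻¹, by simp⟩
    have hf : Function.Injective f := by
      intro p q hpq
      have h : p.out * y * p.out⁻¹ = q.out * y * q.out⁻¹ := congrArg Subtype.val hpq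
      rw [← QuotientGroup.out_eq' p, ← QuotientGroup.out_eq' q, QuotientGroup.eq,
        Subgroup.mem_centralizer_singleton_iff]
      calc p.out⁻¹ * q.out * y = p.out⁻¹ * (q.out * y * q.out⁻¹) * q.out := by group
        _ = y * (p.out⁻¹ * q.out) := by rw [← h]; group
    have := Finite.of_injective f hf
    exact Subgroup.finiteIndex_of_finite_quotient
  rw [Subgroup.centralizer_eq_iInf, ← hS.coe_toFinset]
  exact Subgroup.finiteIndex_iInf' _ fun y _ => single y

/-- A BFC group has a subgroup of finite index with only finitely many commutators, all of them
central in the subgroup. -/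
theorem exists_finiteIndex_finite_central_commutators {G : Type*} [Group G] {n : ℕ}
    (hfin : ∀ y : G, (Set.range fun x : G => x⁻¹ * y * x).Finite)
    (hle : ∀ y : G, (Set.range fun x : G => x⁻¹ * y * x).ncard ≤ n) :
    ∃ (K : Subgroup G) (S : Set G), K.FiniteIndex ∧ S.Finite ∧
      (∀ x ∈ K, ∀ y ∈ K, x⁻¹ * y⁻¹ * x * y ∈ S) ∧ ∀ x ∈ K, ∀ s ∈ S, Commute s x := by
  -- The argument of B. H. Neumann: pick an element `a` whose conjugacy class has maximal size.
  let cl (y : G) : Set G := Set.range fun x : G => x⁻¹ * y * x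
  have hbdd : BddAbove (Set.range fun y => (cl y).ncard) :=
    ⟨n, by rintro _ ⟨y, rfl⟩; exact hle y⟩
  obtain ⟨a, ha⟩ : ∃ a, ∀ y, (cl y).ncard ≤ (cl a).ncard := by
    obtain ⟨a, ha⟩ := Nat.sSup_mem (Set.range_nonempty _) hbdd
    exact ⟨a, fun y => (le_csSup hbdd ⟨y, rfl⟩).trans_eq ha.symm⟩
  choose t ht using fun z : cl a => z.2
  let S : Set G := Set.image2 (fun z w => z * w⁻¹) (cl a) (cl a)
  have hS : S.Finite := (hfin a).image2 _ (hfin a)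
  have hT : (Set.range t).Finite := by
    have := (hfin a).to_subtype
    exact Set.finite_range t
  have := finiteIndex_centralizer_of_finite hfin hT
  have := finiteIndex_centralizer_of_finite hfin hS
  refine ⟨Subgroup.centralizer (Set.range t) ⊓ Subgroup.centralizer S, S, inferInstance, hS, ?_,
    fun x hx s hs => Subgroup.mem_centralizer_iff.1 hx.2 s hs⟩
  intro u hu y _
  have hsub : (u * ·) '' cl a ⊆ cl (u * a) := by
    rintro _ ⟨z, hz, rfl⟩
    have hc : t ⟨z, hz⟩ * u = u * t ⟨z, hz⟩ := Subgroup.mem_centralizer_iff.1 hu.1 _ ⟨_, rfl⟩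
    refine ⟨t ⟨z, hz⟩, ?_⟩
    have hz' : (t ⟨z, hz⟩)⁻¹ * a * t ⟨z, hz⟩ = z := ht ⟨z, hz⟩
    calc (t ⟨z, hz⟩)⁻¹ * (u * a) * t ⟨z, hz⟩
        = (t ⟨z, hz⟩)⁻¹ * (u * t ⟨z, hz⟩) * ((t ⟨z, hz⟩)⁻¹ * a * t ⟨z, hz⟩) := by group
      _ = u * z := by rw [← hc, hz']; group
  have heq := Set.eq_of_subset_of_ncard_le hsub
    ((ha _).trans_eq (Set.ncard_image_of_injective _ (mul_right_injective u)).symm) (hfin _)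
  obtain ⟨z, hz, hzy⟩ : y⁻¹ * (u * a) * y ∈ (u * ·) '' cl a := heq ▸ ⟨y, rfl⟩
  refine ⟨z, hz, y⁻¹ * a * y, ⟨y, rfl⟩, ?_⟩
  have hz' : z = u⁻¹ * (y⁻¹ * (u * a) * y) := eq_inv_mul_of_mul_eq hzy
  simp only [hz']
  group

theorem eventually_dprod {G : Type*} [Group G] (u v : Ultrafilter G) (p : G → Prop) :
    (∀ᶠ z in dprod u v, p z) ↔ ∀ᶠ x in u, ∀ᶠ y in v, p (x * y) := Iff.rfl

theorem eventually_cprod {G : Type*} [Group G] (u v : Ultrafilter G) (p : G → Prop) :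
    (∀ᶠ z in cprod u v, p z) ↔ ∀ᶠ y in v, ∀ᶠ x in u, p (x * y) := Iff.rfl

theorem ultrafilter_ext_eventually {α : Type*} {u v : Ultrafilter α}
    (h : ∀ p : α → Prop, (∀ᶠ z in u, p z) ↔ ∀ᶠ z in v, p z) : u = v :=
  Ultrafilter.ext fun A => h (· ∈ A)

theorem dprod_assoc {G : Type*} [Group G] (u v w : Ultrafilter G) :
    dprod (dprod u v) w = dprod u (dprod v w) :=
  ultrafilter_ext_eventually fun p => by simp only [eventually_dprod, mul_assoc]

theorem dprod_map_mul_right {G : Type*} [Group G] (u v : Ultrafilter G) (g : G) :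
    dprod u (v.map (· * g)) = (dprod u v).map (· * g) :=
  ultrafilter_ext_eventually fun p => by
    simp only [eventually_dprod, Ultrafilter.coe_map, eventually_map, mul_assoc]

theorem cprod_map_mul_right {G : Type*} [Group G] (u v : Ultrafilter G) (g : G) :
    cprod u (v.map (· * g)) = (cprod u v).map (· * g) :=
  ultrafilter_ext_eventually fun p => by
    simp only [eventually_cprod, Ultrafilter.coe_map, eventually_map, mul_assoc]

theorem dprod_pure_eq_cprod_pure {G : Type*} [Group G] (u : Ultrafilter G) (g : G) :
    dprod u (pure g) = cprod u (pure g) :=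
  ultrafilter_ext_eventually fun p => by
    simp only [eventually_dprod, eventually_cprod, Ultrafilter.coe_pure, eventually_pure]

/-- If elements of `u` eventually commute with elements of `v`, then `u ∘ v = v ⋄ u`. -/
theorem cprod_eq_dprod_of_eventually_commute {G : Type*} [Group G] {u v : Ultrafilter G}
    (h : ∀ᶠ y : G in v, ∀ᶠ x : G in u, x * y = y * x) : cprod u v = dprod v u :=
  ultrafilter_ext_eventually fun p => by
    rw [eventually_cprod, eventually_dprod]
    refine eventually_congr (h.mono fun y hy => eventually_congr (hy.mono fun x hx => ?_))
    rw [hx]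

theorem IsPrincipal.of_eventually_eq {α : Type*} {u : Ultrafilter α} {a : α}
    (h : ∀ᶠ x in u, x = a) : IsPrincipal u :=
  let ⟨x, _, hx⟩ := Ultrafilter.eq_pure_of_finite_mem (Set.finite_singleton a) h
  ⟨x, hx⟩

theorem not_isPrincipal_hyperfilter (α : Type*) [Infinite α] : ¬IsPrincipal (hyperfilter α) := by
  rintro ⟨x, hx⟩
  refine notMem_hyperfilter_of_finite (Set.finite_singleton x) ?_
  rw [hx]
  exact Ultrafilter.mem_pure.2 rfl

theorem IsPrincipal.right_of_dprod {G : Type*} [Group G] {u v : Ultrafilter G}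
    (h : IsPrincipal (dprod u v)) : IsPrincipal v := by
  obtain ⟨g, hg⟩ := h
  have hg' : ∀ᶠ z in dprod u v, z = g := by simp [hg]
  obtain ⟨x, hx⟩ := ((eventually_dprod u v _).1 hg').exists
  exact .of_eventually_eq (hx.mono fun y hy => eq_inv_mul_of_mul_eq hy)

/-- `dpow w n` is the `(n + 1)`-st power of `w` with respect to `⋄`. -/
def dpow {G : Type*} [Group G] (w : Ultrafilter G) : ℕ → Ultrafilter G
  | 0 => w
  | n + 1 => dprod w (dpow w n)

theorem dprod_dpow_comm {G : Type*} [Group G] (w : Ultrafilter G) (n : ℕ) :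
    dprod (dpow w n) w = dprod w (dpow w n) := by
  induction n with
  | zero => rfl
  | succ n ih => rw [dpow, dprod_assoc, ih]

theorem not_isPrincipal_dpow {G : Type*} [Group G] {w : Ultrafilter G} (hw : ¬IsPrincipal w)
    (n : ℕ) : ¬IsPrincipal (dpow w n) := by
  induction n with
  | zero => exact hw
  | succ n ih => exact fun h => ih h.right_of_dprod

theorem eventually_mem_dpow {G : Type*} [Group G] {w : Ultrafilter G} {K : Subgroup G}
    (hK : ∀ᶠ x in w, x ∈ K) (n : ℕ) : ∀ᶠ x in dpow w n, x ∈ K := by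
  induction n with
  | zero => exact hK
  | succ n ih =>
    exact (eventually_dprod _ _ _).2 (hK.mono fun x hx => ih.mono fun y hy => K.mul_mem hx hy)

/-- If `K` has only finitely many commutators, all central in `K`, then they have finite order. -/
theorem isOfFinOrder_commutator {G : Type*} [Group G] {K : Subgroup G} {S : Set G}
    (hS : S.Finite) (hcomm : ∀ x ∈ K, ∀ y ∈ K, x⁻¹ * y⁻¹ * x * y ∈ S)
    (hcent : ∀ x ∈ K, ∀ s ∈ S, Commute s x) {x y : G} (hx : x ∈ K) (hy : y ∈ K) :
    IsOfFinOrder (x⁻¹ * y⁻¹ * x * y) := by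
  set c := x⁻¹ * y⁻¹ * x * y with hc
  have hcx : Commute c x := hcent x hx c (hcomm x hx y hy)
  have hconj : y⁻¹ * x * y = x * c := by rw [hc]; group
  rw [← finite_powers]
  refine hS.subset ?_
  rintro _ ⟨k, rfl⟩
  convert hcomm (x ^ k) (K.pow_mem hx k) y hy using 1
  have : y⁻¹ * x ^ k * y = x ^ k * c ^ k := by
    rw [← hcx.symm.mul_pow, ← hconj]
    simpa using (conj_pow (i := k) (a := y⁻¹) (b := x)).symm
  calc c ^ k = (x ^ k)⁻¹ * (x ^ k * c ^ k) := by group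
    _ = (x ^ k)⁻¹ * (y⁻¹ * x ^ k * y) := by rw [this]
    _ = _ := by group

/-- A nonprincipal ultrafilter containing a subgroup with finitely many, central commutators has
a nonprincipal power `u` with `u ⋄ w = u ∘ w`. -/
theorem exists_dprod_eq_cprod_of_mem {G : Type*} [Group G] {K : Subgroup G} {S : Set G}
    (hS : S.Finite) (hcomm : ∀ x ∈ K, ∀ y ∈ K, x⁻¹ * y⁻¹ * x * y ∈ S)
    (hcent : ∀ x ∈ K, ∀ s ∈ S, Commute s x) {w : Ultrafilter G} (hw : ¬IsPrincipal w)
    (hK : ∀ᶠ x in w, x ∈ K) :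
    ∃ u : Ultrafilter G, ¬IsPrincipal u ∧ dprod u w = cprod u w := by
  obtain ⟨c, hcS, hc⟩ : ∃ c ∈ S, ∀ᶠ y in w, ∀ᶠ x in w, x⁻¹ * y⁻¹ * x * y = c := by
    rw [← Ultrafilter.eventually_exists_mem_iff hS]
    filter_upwards [hK] with y hy
    rw [← Ultrafilter.eventually_exists_mem_iff hS]
    filter_upwards [hK] with x hx
    exact ⟨_, hcomm x hx y hy, rfl⟩
  have hfin : IsOfFinOrder c := by
    obtain ⟨y, hy, hyK⟩ := (hc.and hK).exists
    obtain ⟨x, hx, hxK⟩ := (hy.and hK).exists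
    exact hx ▸ isOfFinOrder_commutator hS hcomm hcent hxK hyK
  have hpow (n : ℕ) : ∀ᶠ y in w, ∀ᶠ x in dpow w n, x * y = y * x * c ^ (n + 1) := by
    filter_upwards [hc] with y hy
    have hy' : ∀ᶠ x in w, x * y = y * x * c := hy.mono fun x hx => by rw [← hx]; group
    induction n with
    | zero => simpa [dpow] using hy'
    | succ n ih =>
      refine (eventually_dprod _ _ _).2 (hy'.mono fun x hx => ?_)
      filter_upwards [ih, eventually_mem_dpow hK n] with z hz hzK
      have hcz : c * z = z * c := hcent z hzK c hcS
      calc x * z * y = (x * y) * z * c ^ (n + 1) := by rw [mul_assoc, hz]; group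
        _ = y * x * (c * z) * c ^ (n + 1) := by rw [hx]; group
        _ = y * (x * z) * c ^ (n + 1 + 1) := by rw [hcz, pow_succ' c (n + 1)]; group
  obtain ⟨k, hk, hck⟩ := isOfFinOrder_iff_pow_eq_one.1 hfin
  obtain ⟨n, rfl⟩ := Nat.exists_eq_succ_of_ne_zero hk.ne'
  refine ⟨dpow w n, not_isPrincipal_dpow hw n, ?_⟩
  rw [cprod_eq_dprod_of_eventually_commute, dprod_dpow_comm]
  filter_upwards [hpow n] with y hy
  filter_upwards [hy] with x hx
  rw [hx, hck, mul_one]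

/-- An ultrafilter on `G` contains a right coset of every subgroup of finite index. -/
theorem exists_eventually_mul_mem {G : Type*} [Group G] (K : Subgroup G) [K.FiniteIndex]
    (v : Ultrafilter G) : ∃ g : G, ∀ᶠ x in v, x * g ∈ K := by
  obtain ⟨q, hq⟩ := (v.map fun x => ((x⁻¹ : G) : G ⧸ K)).eq_pure_of_finite
  obtain ⟨g, rfl⟩ := QuotientGroup.mk_surjective q
  have h : ∀ᶠ z in v.map fun x => ((x⁻¹ : G) : G ⧸ K), z = (g : G ⧸ K) := by simp [hq]
  rw [Ultrafilter.coe_map, eventually_map] at h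
  exact ⟨g, h.mono fun x hx => by simpa [QuotientGroup.eq] using hx⟩

/-- Every infinite virtually BFC group admits no DTC ultrafilter: if the infinite group `G`
has a subgroup `H` of finite index with `sup_{y ∈ H} |[y]_H| < ∞`, then for every
`v ∈ βG` there is `u ∈ βG \ G` with `u ⋄ v = u ∘ v`. -/
theorem no_dtc_of_virtually_BFC (G : Type*) [Group G] [Infinite G]
    (H : Subgroup G) (hfi : H.FiniteIndex)
    (hBFC : ∃ n : ℕ, ∀ y : ↥H, {z : ↥H | ∃ x : ↥H, x⁻¹ * y * x = z}.Finite ∧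
        {z : ↥H | ∃ x : ↥H, x⁻¹ * y * x = z}.ncard ≤ n) :
    ∀ v : Ultrafilter G, ∃ u : Ultrafilter G,
      ¬IsPrincipal u ∧ dprod u v = cprod u v := by
  intro v
  by_cases hv : IsPrincipal v
  · obtain ⟨g, rfl⟩ := hv
    exact ⟨hyperfilter G, not_isPrincipal_hyperfilter G, dprod_pure_eq_cprod_pure _ g⟩
  obtain ⟨n, hn⟩ := hBFC
  obtain ⟨K, S, hKfi, hS, hcomm, hcent⟩ := exists_finiteIndex_finite_central_commutators
    (fun y => (hn y).1) (fun y => (hn y).2)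
  have : (K.map H.subtype).FiniteIndex :=
    ⟨by rw [Subgroup.index_map_subtype]; exact mul_ne_zero hKfi.index_ne_zero hfi.index_ne_zero⟩
  obtain ⟨g, hg⟩ := exists_eventually_mul_mem (K.map H.subtype) v
  have hw : ¬IsPrincipal (v.map (· * g)) := by
    rintro ⟨a, ha⟩
    have h : ∀ᶠ z in v.map (· * g), z = a := by simp [ha]
    rw [Ultrafilter.coe_map, eventually_map] at h
    exact hv (.of_eventually_eq (h.mono fun x hx => eq_mul_inv_of_mul_eq hx))
  obtain ⟨u, hu, huw⟩ := exists_dprod_eq_cprod_of_mem (K := K.map H.subtype)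
    (S := H.subtype '' S) (hS.image _)
    (by
      rintro _ ⟨x, hx, rfl⟩ _ ⟨y, hy, rfl⟩
      exact ⟨_, hcomm x hx y hy, by simp⟩)
    (by
      rintro _ ⟨x, hx, rfl⟩ _ ⟨s, hs, rfl⟩
      exact (hcent x hx s hs).map H.subtype)
    hw hg
  refine ⟨u, hu, ?_⟩
  have hv' : v = (v.map (· * g)).map (· * g⁻¹) :=
    ultrafilter_ext_eventually fun p => by simp
  rw [hv', dprod_map_mul_right, cprod_map_mul_right, huw]
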